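/- Let H be a complex Hilbert space. Then for every a in the closed unit ball of C_1(H) (with respect to the trace norm), the inequality λ(a) ≥ (1 − ‖a‖₁ + 2‖a‖_∞)/2 holds, where ‖a‖_∞ denotes the operator norm of a. -/

import Mathlib

/-! Setting: `H` is a complex Hilbert space, and we consider the space `C₁(H)` of trace class
operators on `H` (more generally the Schatten classes `C_p(H)`), regarded as those bounded
operators `a : H →L[ℂ] H` that are compact and whose sequence of singular values is
`p`-summable. The singular values `μₙ(a)` of a compact operator `a` (the eigenvalues of
`|a| = (a^* a)^(1/2)` arranged in decreasing order and repeated according to multiplicity)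
are realized here via the approximation numbers, which coincide with them. -/

/-- `sValue a n` is the `n`-th approximation number (`0`-indexed) of `a`, namely the distance
from `a` to the operators of rank at most `n`.  For a compact operator on a Hilbert space this
coincides with the `(n+1)`-th singular value `μ_{n+1}(a)`, i.e. the `(n+1)`-th eigenvalue of
`|a| = (a^* a)^(1/2)` arranged in decreasing order and repeated according to multiplicity.  In
particular `sValue a 0 = μ₁(a) = ‖a‖`. -/
noncomputable def sValue {H : Type*} [NormedAddCommGroup H] [InnerProductSpace ℂ H]
    (a : H →L[ℂ] H) (n : ℕ) : ℝ :=
  sInf {r : ℝ | ∃ F : H →L[ℂ] H, LinearMap.rank (F : H →ₗ[ℂ] H) ≤ (n : Cardinal) ∧ r = ‖a - F‖}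

/-- Membership in the Schatten class `C_p(H)`: `a` is a compact operator with
`‖a‖_p^p = ∑ₙ μₙ(a)^p < ∞`. -/
def MemSchatten {H : Type*} [NormedAddCommGroup H] [InnerProductSpace ℂ H]
    (p : ℝ) (a : H →L[ℂ] H) : Prop :=
  IsCompactOperator a ∧ Summable (fun n => sValue a n ^ p)

/-- Membership in the trace class `C₁(H)`: `a` is a compact operator with
`‖a‖₁ = tr |a| = ∑ₙ μₙ(a) < ∞`. -/
def MemTraceClass {H : Type*} [NormedAddCommGroup H] [InnerProductSpace ℂ H]
    (a : H →L[ℂ] H) : Prop :=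
  IsCompactOperator a ∧ Summable (fun n => sValue a n)

/-- The trace norm `‖a‖₁ = tr |a| = ∑ₙ μₙ(a)`. -/
noncomputable def traceNorm {H : Type*} [NormedAddCommGroup H] [InnerProductSpace ℂ H]
    (a : H →L[ℂ] H) : ℝ :=
  ∑' n, sValue a n

/-- The closed unit ball of `C₁(H)` with respect to the trace norm `‖·‖₁`. -/
def traceBall (H : Type*) [NormedAddCommGroup H] [InnerProductSpace ℂ H] :
    Set (H →L[ℂ] H) :=
  {x | MemTraceClass x ∧ traceNorm x ≤ 1}

/-- The λ-function of Aron and Lohman on the closed unit ball of `C₁(H)`: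
`λ(a) = sup { t : (e, y, t) ∈ ∂ₑ(B) × B × [0,1] is a triplet amenable to a }`,
where a triplet `(e, y, t)` is amenable to `a` when `a = t • e + (1 - t) • y`. -/
noncomputable def lambdaFn {H : Type*} [NormedAddCommGroup H] [InnerProductSpace ℂ H]
    (a : H →L[ℂ] H) : ℝ :=
  sSup {t : ℝ | t ∈ Set.Icc (0 : ℝ) 1 ∧
    ∃ e ∈ Set.extremePoints ℝ (traceBall H), ∃ y ∈ traceBall H, a = t • e + (1 - t) • y}

/-- A minimal (i.e. rank-one) partial isometry: `e e^* e = e` and `e` has rank one. -/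
def IsMinimalPartialIsometry {H : Type*} [NormedAddCommGroup H] [InnerProductSpace ℂ H]
    [CompleteSpace H] (e : H →L[ℂ] H) : Prop :=
  e ∘L (ContinuousLinearMap.adjoint e) ∘L e = e ∧ LinearMap.rank (e : H →ₗ[ℂ] H) = 1

/-- The rank one operator `η ⊗ ξ : ζ ↦ ⟨ζ, ξ⟩ η` (Mathlib's inner product being conjugate
linear in the first variable, this is `ζ ↦ ⟪ξ, ζ⟫ • η`). -/
noncomputable def rankOneOp {H : Type*} [NormedAddCommGroup H] [InnerProductSpace ℂ H]
    (η ξ : H) : H →L[ℂ] H :=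
  (innerSL ℂ ξ).smulRight η

open ContinuousLinearMap in
/-- A compact operator on a Hilbert space attains its norm at a unit vector. -/
theorem IsCompactOperator.exists_norm_apply_eq {H : Type*} [NormedAddCommGroup H]
    [InnerProductSpace ℂ H] [CompleteSpace H] [Nontrivial H] {a : H →L[ℂ] H}
    (ha : IsCompactOperator a) : ∃ ξ : H, ‖ξ‖ = 1 ∧ ‖a ξ‖ = ‖a‖ := by
  rcases eq_or_ne a 0 with rfl | h0
  · obtain ⟨ξ, hξ⟩ := exists_norm_eq H zero_le_one
    exact ⟨ξ, hξ, by simp⟩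
  have hs : 0 < ‖a‖ := norm_pos_iff.2 h0
  have hK : IsCompact (closure (a '' Metric.closedBall 0 1)) :=
    ha.isCompact_closure_image_closedBall (f := (a : H →ₗ[ℂ] H)) 1
  obtain ⟨w, hwK, hw⟩ := hK.exists_isMaxOn
    ⟨0, subset_closure ⟨0, by simp, by simp⟩⟩ continuous_norm.continuousOn
  have hsw : ‖a‖ ≤ ‖w‖ := by
    refine a.opNorm_le_of_unit_norm (𝕜 := ℂ) (norm_nonneg _) fun u hu => ?_
    exact hw (subset_closure ⟨u, by simp [hu], rfl⟩)
  have hadj : ‖w‖ ^ 2 ≤ ‖adjoint a w‖ := by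
    have hcl : IsClosed {w : H | ‖w‖ ^ 2 ≤ ‖adjoint a w‖} :=
      isClosed_le (by fun_prop) (by fun_prop)
    refine closure_minimal ?_ hcl hwK
    rintro _ ⟨u, hu, rfl⟩
    have hu : ‖u‖ ≤ 1 := by simpa using hu
    have h1 : ‖a u‖ ^ 2 = RCLike.re (inner ℂ (adjoint a (a u)) u) := by
      rw [adjoint_inner_left, inner_self_eq_norm_sq]
    have h2 := (RCLike.re_le_norm _).trans (norm_inner_le_norm (𝕜 := ℂ) (adjoint a (a u)) u)
    have h3 := mul_le_of_le_one_right (norm_nonneg (adjoint a (a u))) hu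
    simp only [Set.mem_ofPred_eq]
    linarith
  have hwpos : 0 < ‖w‖ := hs.trans_le hsw
  set v := adjoint a w with hv
  have hvpos : 0 < ‖v‖ := lt_of_lt_of_le (by positivity) hadj
  have hav : ‖v‖ ^ 2 ≤ ‖a v‖ * ‖w‖ := by
    have h1 : ‖v‖ ^ 2 = RCLike.re (inner ℂ (a v) w) := by
      rw [← adjoint_inner_right, ← hv, inner_self_eq_norm_sq]
    rw [h1]
    exact (RCLike.re_le_norm _).trans (norm_inner_le_norm (𝕜 := ℂ) _ _)
  have hle : ‖a‖ * ‖v‖ ≤ ‖a v‖ := by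
    refine le_of_mul_le_mul_right ?_ hwpos
    calc ‖a‖ * ‖v‖ * ‖w‖ ≤ ‖w‖ * ‖v‖ * ‖w‖ := by gcongr
      _ = ‖v‖ * ‖w‖ ^ 2 := by ring
      _ ≤ ‖v‖ * ‖v‖ := by gcongr
      _ ≤ ‖a v‖ * ‖w‖ := by rw [← sq]; exact hav
  refine ⟨((‖v‖⁻¹ : ℝ) : ℂ) • v, ?_, ?_⟩
  · rw [norm_smul, Complex.norm_real, norm_inv, norm_norm, inv_mul_cancel₀ hvpos.ne']
  · have := le_antisymm (a.le_opNorm v) hle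
    rw [map_smul, norm_smul, Complex.norm_real, norm_inv, norm_norm, this]
    field_simp

theorem inner_self_eq_ofReal_norm_sq {H : Type*} [NormedAddCommGroup H]
    [InnerProductSpace ℂ H] (x : H) : inner ℂ x x = ((‖x‖ ^ 2 : ℝ) : ℂ) := by
  rw [inner_self_eq_norm_sq_to_K]
  norm_cast

open ContinuousLinearMap in
theorem adjoint_apply_apply_of_norm_apply_eq {H : Type*} [NormedAddCommGroup H]
    [InnerProductSpace ℂ H] [CompleteSpace H] {a : H →L[ℂ] H} {ξ : H} (hξ : ‖ξ‖ = 1)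
    (haξ : ‖a ξ‖ = ‖a‖) : adjoint a (a ξ) = ((‖a‖ ^ 2 : ℝ) : ℂ) • ξ := by
  rw [← sub_eq_zero, ← norm_eq_zero, ← sq_eq_zero_iff]
  refine le_antisymm ?_ (sq_nonneg _)
  have h1 : ‖adjoint a (a ξ)‖ ≤ ‖a‖ * ‖a‖ := by
    have := (adjoint a).le_opNorm (a ξ)
    rwa [LinearIsometryEquiv.norm_map, haξ] at this
  have h2 : RCLike.re (inner ℂ (adjoint a (a ξ)) (((‖a‖ ^ 2 : ℝ) : ℂ) • ξ)) = ‖a‖ ^ 4 := by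
    rw [inner_smul_right, adjoint_inner_left, inner_self_eq_ofReal_norm_sq, haξ, ← Complex.ofReal_mul]
    refine (Complex.ofReal_re (‖a‖ ^ 2 * ‖a‖ ^ 2)).trans ?_
    ring
  rw [norm_sub_sq (𝕜 := ℂ), h2, norm_smul, hξ, Complex.norm_real, Real.norm_of_nonneg (sq_nonneg _)]
  nlinarith [mul_self_le_mul_self (norm_nonneg _) h1]

section SingularValues

variable {H : Type*} [NormedAddCommGroup H] [InnerProductSpace ℂ H]

theorem rankOneOp_apply (η ξ u : H) : rankOneOp η ξ u = inner ℂ ξ u • η := rfl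

theorem rank_rankOneOp_le_one (η ξ : H) :
    LinearMap.rank (rankOneOp η ξ : H →ₗ[ℂ] H) ≤ 1 := by
  have hr : LinearMap.range (rankOneOp η ξ : H →ₗ[ℂ] H) ≤ Submodule.span ℂ {η} := by
    rintro _ ⟨u, rfl⟩
    exact Submodule.smul_mem _ _ (Submodule.mem_span_singleton_self η)
  exact (Submodule.rank_mono hr).trans ((rank_span_le _).trans (by simp))

theorem isCompactOperator_rankOneOp (η ξ : H) : IsCompactOperator (rankOneOp η ξ) := by
  have h1 : IsCompactOperator (innerSL ℂ ξ) :=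
    isCompactOperator_of_locallyCompactSpace_dom (innerSL ℂ ξ)
  exact h1.clm_comp (ContinuousLinearMap.toSpanSingleton ℂ η)

theorem norm_rankOneOp_apply_sub_sq {ξ : H} (hξ : ‖ξ‖ = 1) (u : H) :
    ‖u - inner ℂ ξ u • ξ‖ ^ 2 = ‖u‖ ^ 2 - ‖inner ℂ ξ u‖ ^ 2 := by
  have h : inner ℂ (u - inner ℂ ξ u • ξ) (inner ℂ ξ u • ξ) = 0 := by
    rw [inner_smul_right, inner_sub_left, inner_smul_left, inner_self_eq_norm_sq_to_K, hξ,
      inner_conj_symm]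
    simp
  have := norm_add_sq_eq_norm_sq_add_norm_sq_of_inner_eq_zero _ _ h
  rw [sub_add_cancel, norm_smul, hξ] at this
  nlinarith

theorem bddBelow_sValue (a : H →L[ℂ] H) (n : ℕ) :
    BddBelow {r : ℝ | ∃ F : H →L[ℂ] H,
      LinearMap.rank (F : H →ₗ[ℂ] H) ≤ (n : Cardinal) ∧ r = ‖a - F‖} :=
  ⟨0, by rintro _ ⟨F, -, rfl⟩; exact norm_nonneg _⟩

theorem sValue_le {a F : H →L[ℂ] H} {n : ℕ}
    (hF : LinearMap.rank (F : H →ₗ[ℂ] H) ≤ (n : Cardinal)) : sValue a n ≤ ‖a - F‖ :=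
  csInf_le (bddBelow_sValue a n) ⟨F, hF, rfl⟩

theorem le_sValue {a : H →L[ℂ] H} {n : ℕ} {c : ℝ}
    (h : ∀ F : H →L[ℂ] H, LinearMap.rank (F : H →ₗ[ℂ] H) ≤ (n : Cardinal) → c ≤ ‖a - F‖) :
    c ≤ sValue a n := by
  refine le_csInf ⟨_, 0, ?_, rfl⟩ ?_
  · simp [LinearMap.rank_zero]
  · rintro _ ⟨F, hF, rfl⟩
    exact h F hF

theorem sValue_nonneg (a : H →L[ℂ] H) (n : ℕ) : 0 ≤ sValue a n :=
  le_sValue fun _ _ => norm_nonneg _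

theorem norm_le_sValue_zero (a : H →L[ℂ] H) : ‖a‖ ≤ sValue a 0 := by
  refine le_sValue fun F hF => ?_
  have h0 : F = 0 := by
    rw [Nat.cast_zero, nonpos_iff_eq_zero, LinearMap.rank, Submodule.rank_eq_zero,
      LinearMap.range_eq_bot] at hF
    ext u
    exact LinearMap.congr_fun hF u
  simp [h0]

theorem sValue_le_norm (a : H →L[ℂ] H) (n : ℕ) : sValue a n ≤ ‖a‖ := by
  simpa using sValue_le (a := a) (F := 0) (n := n) (by simp [LinearMap.rank_zero])

theorem rank_le_of_ker_le {f g : H →ₗ[ℂ] H} (h : LinearMap.ker f ≤ LinearMap.ker g) :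
    LinearMap.rank g ≤ LinearMap.rank f := by
  obtain ⟨k, hk⟩ : ∃ k : H →ₗ[ℂ] H, k ∘ₗ f = g := by
    obtain ⟨k, hk⟩ := (((LinearMap.ker f).liftQ g h) ∘ₗ
      f.quotKerEquivRange.symm.toLinearMap).exists_extend
    refine ⟨k, LinearMap.ext fun u => ?_⟩
    have := LinearMap.congr_fun hk ⟨f u, u, rfl⟩
    rw [LinearMap.comp_apply, Submodule.subtype_apply] at this
    rw [LinearMap.comp_apply, this, LinearMap.comp_apply]
    have hq : f.quotKerEquivRange.symm ⟨f u, u, rfl⟩ = (LinearMap.ker f).mkQ u :=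
      f.quotKerEquivRange.symm_apply_eq.2 (Subtype.ext rfl)
    rw [LinearEquiv.coe_coe, hq, Submodule.mkQ_apply, Submodule.liftQ_apply]
  rw [← hk]
  exact LinearMap.rank_comp_le_right _ _

theorem sValue_smul_le (κ : ℝ) (a : H →L[ℂ] H) (n : ℕ) :
    sValue (κ • a) n ≤ |κ| * sValue a n := by
  rcases eq_or_ne κ 0 with rfl | hκ
  · simpa using sValue_le_norm (0 : H →L[ℂ] H) n
  have hκ' : 0 < |κ| := abs_pos.2 hκ
  rw [← div_le_iff₀' hκ']
  refine le_sValue fun F hF => ?_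
  rw [div_le_iff₀' hκ', ← Real.norm_eq_abs, ← norm_smul, smul_sub]
  refine sValue_le ((rank_le_of_ker_le fun u hu => ?_).trans hF)
  have hu' : F u = 0 := hu
  simp [hu']

/-- If `b` is bounded by `M` on the kernel of an operator of rank at most `n`, then the `n`-th
approximation number of `b` is at most `M`. -/
theorem sValue_le_of_ker [CompleteSpace H] {b F : H →L[ℂ] H} {n : ℕ} {M : ℝ} (hM : 0 ≤ M)
    (hF : LinearMap.rank (F : H →ₗ[ℂ] H) ≤ (n : Cardinal))
    (h : ∀ u, F u = 0 → ‖b u‖ ≤ M * ‖u‖) : sValue b n ≤ M := by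
  let K : Submodule ℂ H := LinearMap.ker (F : H →ₗ[ℂ] H)
  have hKc : IsClosed (K : Set H) := F.isClosed_ker
  have : CompleteSpace K := hKc.completeSpace_coe
  have hG : LinearMap.rank ((b - b ∘L K.starProjection : H →L[ℂ] H) : H →ₗ[ℂ] H) ≤
      (n : Cardinal) := by
    refine (rank_le_of_ker_le fun u hu => ?_).trans hF
    have : K.starProjection u = u := Submodule.starProjection_eq_self_iff.2 hu
    simp [this]
  refine (sValue_le hG).trans ?_
  rw [sub_sub_cancel]
  refine ContinuousLinearMap.opNorm_le_bound _ hM fun u => ?_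
  have hmem : F (K.starProjection u) = 0 := K.starProjection_apply_mem u
  exact (h _ hmem).trans (by gcongr; exact K.norm_starProjection_apply_le u)

/-- Composing with the projection onto the complement of a nonzero vector of the range of `F`
lowers the rank of `F`. -/
theorem exists_rank_le_of_apply_ne_zero [CompleteSpace H] {F : H →L[ℂ] H} {n : ℕ} {ξ : H}
    (hF : LinearMap.rank (F : H →ₗ[ℂ] H) ≤ ((n + 1 : ℕ) : Cardinal)) (hξ : F ξ ≠ 0) :
    ∃ F' : H →L[ℂ] H, LinearMap.rank (F' : H →ₗ[ℂ] H) ≤ (n : Cardinal) ∧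
      ∀ v, F' v = 0 → ∃ c : ℂ, F v = c • F ξ := by
  let L : Submodule ℂ H := Submodule.span ℂ {F ξ}
  let F' : H →L[ℂ] H := F - L.starProjection ∘L F
  have hker : ∀ v, F' v = 0 → ∃ c : ℂ, F v = c • F ξ := by
    intro v hv
    have h1 : F v = L.starProjection (F v) := sub_eq_zero.1 hv
    have h2 : F v ∈ L := h1 ▸ L.starProjection_apply_mem (F v)
    obtain ⟨c, hc⟩ := Submodule.mem_span_singleton.1 h2
    exact ⟨c, hc.symm⟩
  refine ⟨F', ?_, hker⟩
  have hfin : FiniteDimensional ℂ (LinearMap.range (F : H →ₗ[ℂ] H)) :=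
    Module.rank_lt_aleph0_iff.1 (hF.trans_lt (Cardinal.natCast_lt_aleph0))
  have hFL : F ξ ∈ L := Submodule.mem_span_singleton_self _
  have hle : LinearMap.range (F' : H →ₗ[ℂ] H) ≤ LinearMap.range (F : H →ₗ[ℂ] H) := by
    rintro _ ⟨u, rfl⟩
    refine Submodule.sub_mem _ ⟨u, rfl⟩ ?_
    obtain ⟨c, hc⟩ := Submodule.mem_span_singleton.1 (L.starProjection_apply_mem (F u))
    exact ⟨c • ξ, by simpa using hc⟩
  have hlt : LinearMap.range (F' : H →ₗ[ℂ] H) < LinearMap.range (F : H →ₗ[ℂ] H) := by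
    refine lt_of_le_of_ne hle fun heq => hξ ?_
    have hmem : F ξ ∈ LinearMap.range (F' : H →ₗ[ℂ] H) := heq ▸ ⟨ξ, rfl⟩
    obtain ⟨u, hu⟩ := hmem
    have hu' : F u - L.starProjection (F u) = F ξ := hu
    have h0 := L.starProjection_inner_eq_zero (F u) (F ξ) hFL
    rw [hu'] at h0
    exact inner_self_eq_zero.1 h0
  have hfin' := Submodule.finiteDimensional_of_le hle
  have h1 := Submodule.finrank_lt_finrank_of_lt hlt
  rw [LinearMap.rank, ← Module.finrank_eq_rank] at hF ⊢
  norm_cast at hF ⊢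
  omega

theorem inner_apply_sub_rankOneOp [CompleteSpace H] {a : H →L[ℂ] H} {ξ : H} (hξ : ‖ξ‖ = 1)
    (haξ : ‖a ξ‖ = ‖a‖) (u : H) : inner ℂ (a ξ) ((a - rankOneOp (a ξ) ξ) u) = 0 := by
  rw [sub_apply, rankOneOp_apply, inner_sub_right, inner_smul_right,
    ← ContinuousLinearMap.adjoint_inner_left, adjoint_apply_apply_of_norm_apply_eq hξ haξ,
    inner_smul_left, inner_self_eq_ofReal_norm_sq, haξ, Complex.conj_ofReal]
  ring

/-- Deflation: removing the leading singular pair shifts the singular values. -/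
theorem sValue_sub_rankOneOp_le [CompleteSpace H] {a : H →L[ℂ] H} {ξ : H} (hξ : ‖ξ‖ = 1)
    (haξ : ‖a ξ‖ = ‖a‖) (n : ℕ) :
    sValue (a - rankOneOp (a ξ) ξ) n ≤ sValue a (n + 1) := by
  set b := a - rankOneOp (a ξ) ξ with hb
  have hsq : ∀ u, ‖b u‖ ^ 2 = ‖a u‖ ^ 2 - ‖inner ℂ ξ u‖ ^ 2 * ‖a‖ ^ 2 := by
    intro u
    have h := norm_add_sq_eq_norm_sq_add_norm_sq_of_inner_eq_zero (𝕜 := ℂ)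
      (inner ℂ ξ u • a ξ) (b u) (by
        rw [inner_smul_left, hb, inner_apply_sub_rankOneOp hξ haξ, mul_zero])
    have h2 : inner ℂ ξ u • a ξ + b u = a u := by
      simp [hb, rankOneOp_apply]
    rw [h2, norm_smul, haξ] at h
    nlinarith
  have hbξ : b ξ = 0 := by
    simp [hb, rankOneOp_apply, inner_self_eq_norm_sq_to_K, hξ]
  refine le_sValue fun F hF => ?_
  set M := ‖a - F‖ with hM
  have hM0 : 0 ≤ M := norm_nonneg _
  have haF : ∀ u, F u = 0 → ‖a u‖ ≤ M * ‖u‖ := by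
    intro u hu
    simpa [hu] using (a - F).le_opNorm u
  by_cases hFξ : F ξ = 0
  · have h1 : ‖a‖ ≤ M := by simpa [haξ, hξ] using haF ξ hFξ
    refine (sValue_le_norm b n).trans (le_trans ?_ h1)
    refine ContinuousLinearMap.opNorm_le_bound _ (norm_nonneg _) fun u => ?_
    refine le_trans ?_ (a.le_opNorm u)
    refine le_of_sq_le_sq ?_ (norm_nonneg _)
    rw [hsq]
    nlinarith [mul_nonneg (sq_nonneg ‖inner ℂ ξ u‖) (sq_nonneg ‖a‖)]
  by_cases hMa : ‖a‖ ≤ M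
  · refine (sValue_le_norm b n).trans (le_trans ?_ hMa)
    refine ContinuousLinearMap.opNorm_le_bound _ (norm_nonneg _) fun u => ?_
    refine le_trans ?_ (a.le_opNorm u)
    refine le_of_sq_le_sq ?_ (norm_nonneg _)
    rw [hsq]
    nlinarith [mul_nonneg (sq_nonneg ‖inner ℂ ξ u‖) (sq_nonneg ‖a‖)]
  obtain ⟨F', hF', hker⟩ := exists_rank_le_of_apply_ne_zero hF hFξ
  refine sValue_le_of_ker hM0 hF' fun v hv => ?_
  obtain ⟨c, hc⟩ := hker v hv
  set u := v - c • ξ with hu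
  have hFu : F u = 0 := by simp [hu, hc]
  have hbv : b v = b u := by simp [hu, hbξ]
  have hproj : u - inner ℂ ξ u • ξ = v - inner ℂ ξ v • ξ := by
    have : inner ℂ ξ u = inner ℂ ξ v - c := by
      rw [hu, inner_sub_right, inner_smul_right, inner_self_eq_ofReal_norm_sq, hξ]
      simp
    rw [this, hu, sub_smul]
    abel
  have h1 := norm_rankOneOp_apply_sub_sq hξ u
  have h2 := norm_rankOneOp_apply_sub_sq hξ v
  rw [hproj, h2] at h1
  have h3 := haF u hFu
  have h4 : M ^ 2 ≤ ‖a‖ ^ 2 := by gcongr; exact (not_le.1 hMa).le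
  have h5 : ‖a u‖ ^ 2 ≤ M ^ 2 * ‖u‖ ^ 2 := by rw [← mul_pow]; gcongr
  refine le_of_sq_le_sq ?_ (by positivity)
  rw [hbv, hsq, mul_pow]
  nlinarith [mul_le_mul_of_nonneg_left h4 (sq_nonneg ‖inner ℂ ξ u‖),
    mul_nonneg (sq_nonneg M) (sq_nonneg ‖inner ℂ ξ v‖)]

theorem sValue_smul_rankOneOp_add_le_max [CompleteSpace H] {b : H →L[ℂ] H} {η ξ : H}
    (hη : ‖η‖ = 1) (hξ : ‖ξ‖ = 1) (hbξ : b ξ = 0) (hbη : ∀ u, inner ℂ η (b u) = 0) (r : ℝ)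
    (n : ℕ) : sValue (r • rankOneOp η ξ + b) n ≤ max |r| (sValue b n) := by
  refine le_of_forall_pos_le_add fun ε hε => ?_
  obtain ⟨F, hF, hFε⟩ : ∃ F : H →L[ℂ] H, LinearMap.rank (F : H →ₗ[ℂ] H) ≤ (n : Cardinal) ∧
      ‖b - F‖ < sValue b n + ε := by
    by_contra! hcon
    have := le_sValue hcon
    linarith
  set M := max |r| (sValue b n) + ε with hM
  have hrM : |r| ≤ M := by linarith [le_max_left |r| (sValue b n)]
  have hFM : ‖b - F‖ ≤ M := by linarith [le_max_right |r| (sValue b n)]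
  have hM0 : 0 ≤ M := (abs_nonneg r).trans hrM
  have hrank : LinearMap.rank ((F ∘L (ContinuousLinearMap.id ℂ H - rankOneOp ξ ξ) : H →L[ℂ] H) :
      H →ₗ[ℂ] H) ≤ (n : Cardinal) :=
    (LinearMap.rank_comp_le_left ((ContinuousLinearMap.id ℂ H - rankOneOp ξ ξ : H →L[ℂ] H) :
      H →ₗ[ℂ] H) (F : H →ₗ[ℂ] H)).trans hF
  refine sValue_le_of_ker hM0 hrank fun u hu => ?_
  set v := u - inner ℂ ξ u • ξ with hv
  have hFv : F v = 0 := hu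
  have hbv : b v = b u := by simp [hv, hbξ]
  have h1 : ‖b u‖ ≤ M * ‖v‖ := by
    rw [← hbv]
    have := (b - F).le_opNorm v
    rw [sub_apply, hFv, sub_zero] at this
    exact this.trans (by gcongr)
  have h2 := norm_rankOneOp_apply_sub_sq hξ u
  have h3 := norm_add_sq_eq_norm_sq_add_norm_sq_of_inner_eq_zero (𝕜 := ℂ)
    (r • (inner ℂ ξ u • η)) (b u) (by
      rw [← Complex.coe_smul, inner_smul_left, inner_smul_left, hbη]; simp)
  have h4 : ‖r • (inner ℂ ξ u • η)‖ = |r| * ‖inner ℂ ξ u‖ := by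
    rw [norm_smul, norm_smul, hη, mul_one, Real.norm_eq_abs]
  have h5 : ‖b u‖ ^ 2 ≤ M ^ 2 * ‖v‖ ^ 2 := by rw [← mul_pow]; gcongr
  have h6 : |r| ^ 2 ≤ M ^ 2 := by gcongr
  refine le_of_sq_le_sq ?_ (by positivity)
  change ‖r • (inner ℂ ξ u • η) + b u‖ ^ 2 ≤ _
  rw [sq, h3, h4, mul_pow]
  rw [← hv] at h2
  nlinarith [mul_le_mul_of_nonneg_right h6 (sq_nonneg ‖inner ℂ ξ u‖)]

theorem sValue_succ_rankOneOp_add_le (b : H →L[ℂ] H) (η ξ : H) (r : ℝ) (n : ℕ) :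
    sValue (r • rankOneOp η ξ + b) (n + 1) ≤ sValue b n := by
  refine le_sValue fun F hF => ?_
  have hr : r • rankOneOp η ξ = rankOneOp ((r : ℂ) • η) ξ := by
    ext u
    simp only [smul_apply, rankOneOp_apply]
    rw [← Complex.coe_smul, smul_comm]
  have hrank : LinearMap.rank ((r • rankOneOp η ξ + F : H →L[ℂ] H) : H →ₗ[ℂ] H) ≤
      ((n + 1 : ℕ) : Cardinal) := by
    rw [hr]
    refine (LinearMap.rank_add_le (rankOneOp ((r : ℂ) • η) ξ : H →ₗ[ℂ] H)
      (F : H →ₗ[ℂ] H)).trans ?_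
    rw [Nat.cast_succ, add_comm]
    exact add_le_add hF (rank_rankOneOp_le_one _ _)
  simpa using sValue_le (a := r • rankOneOp η ξ + b) hrank

end SingularValues

theorem tsum_le_add_tsum_of_le_max_of_succ_le {f g : ℕ → ℝ} {ρ : ℝ} (hρ : 0 ≤ ρ)
    (hf : Summable f) (hg : Summable g) (hmax : ∀ n, f n ≤ max ρ (g n))
    (hsucc : ∀ n, f (n + 1) ≤ g n) : ∑' n, f n ≤ ρ + ∑' n, g n := by
  by_cases h : ∃ k, g k < ρ
  · classical
    set k := Nat.find h
    have hk1 : g k < ρ := Nat.find_spec h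
    have hk2 : ∀ i < k, f i ≤ g i := fun i hi =>
      (hmax i).trans (max_le (not_lt.1 (Nat.find_min h hi)) le_rfl)
    have hfk : f k ≤ ρ := (hmax k).trans (max_le le_rfl hk1.le)
    rw [← hf.sum_add_tsum_nat_add (k + 1), ← hg.sum_add_tsum_nat_add k, Finset.sum_range_succ]
    have h1 : ∑ i ∈ Finset.range k, f i ≤ ∑ i ∈ Finset.range k, g i :=
      Finset.sum_le_sum fun i hi => hk2 i (Finset.mem_range.1 hi)
    have h2 : ∑' i, f (i + (k + 1)) ≤ ∑' i, g (i + k) :=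
      ((summable_nat_add_iff (k + 1)).2 hf).tsum_le_tsum (fun i => hsucc (i + k))
        ((summable_nat_add_iff k).2 hg)
    linarith
  · push Not at h
    have := hf.tsum_le_tsum (fun i => (hmax i).trans (max_le (h i) le_rfl)) hg
    linarith

section TraceBall

variable {H : Type*} [NormedAddCommGroup H] [InnerProductSpace ℂ H]

theorem MemTraceClass.smul_rankOneOp_add {b : H →L[ℂ] H} (hb : MemTraceClass b) (η ξ : H)
    (r : ℝ) : MemTraceClass (r • rankOneOp η ξ + b) := by
  refine ⟨((isCompactOperator_rankOneOp η ξ).smul r).add hb.1, ?_⟩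
  rw [← summable_nat_add_iff 1]
  exact hb.2.of_nonneg_of_le (fun n => sValue_nonneg _ _)
    fun n => sValue_succ_rankOneOp_add_le b η ξ r n

theorem traceNorm_smul_rankOneOp_add_le [CompleteSpace H] {b : H →L[ℂ] H}
    (hb : MemTraceClass b) {η ξ : H} (hη : ‖η‖ = 1) (hξ : ‖ξ‖ = 1) (hbξ : b ξ = 0)
    (hbη : ∀ u, inner ℂ η (b u) = 0) (r : ℝ) :
    traceNorm (r • rankOneOp η ξ + b) ≤ |r| + traceNorm b :=
  tsum_le_add_tsum_of_le_max_of_succ_le (abs_nonneg r) (hb.smul_rankOneOp_add η ξ r).2 hb.2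
    (sValue_smul_rankOneOp_add_le_max hη hξ hbξ hbη r) (sValue_succ_rankOneOp_add_le b η ξ r)

theorem MemTraceClass.smul {b : H →L[ℂ] H} (hb : MemTraceClass b) (κ : ℝ) :
    MemTraceClass (κ • b) :=
  ⟨hb.1.smul κ, (hb.2.mul_left |κ|).of_nonneg_of_le (fun _ => sValue_nonneg _ _)
    (sValue_smul_le κ b)⟩

theorem traceNorm_smul_le {b : H →L[ℂ] H} (hb : MemTraceClass b) (κ : ℝ) :
    traceNorm (κ • b) ≤ |κ| * traceNorm b := by
  rw [traceNorm, traceNorm, ← tsum_mul_left]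
  exact (hb.smul κ).2.tsum_le_tsum (sValue_smul_le κ b) (hb.2.mul_left |κ|)

theorem memTraceClass_zero : MemTraceClass (0 : H →L[ℂ] H) := by
  have h0 : sValue (0 : H →L[ℂ] H) = 0 := funext fun n =>
    le_antisymm ((sValue_le_norm _ n).trans_eq norm_zero) (sValue_nonneg _ n)
  exact ⟨isCompactOperator_zero, by rw [h0]; exact summable_zero⟩

theorem traceNorm_zero : traceNorm (0 : H →L[ℂ] H) = 0 := by
  have h0 : sValue (0 : H →L[ℂ] H) = 0 := funext fun n =>
    le_antisymm ((sValue_le_norm _ n).trans_eq norm_zero) (sValue_nonneg _ n)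
  rw [traceNorm, h0]
  exact tsum_zero

theorem zero_mem_traceBall : (0 : H →L[ℂ] H) ∈ traceBall H :=
  ⟨memTraceClass_zero, by rw [traceNorm_zero]; exact zero_le_one⟩

theorem MemTraceClass.sub_rankOneOp [CompleteSpace H] {a : H →L[ℂ] H} (ha : MemTraceClass a)
    {ξ : H} (hξ : ‖ξ‖ = 1) (haξ : ‖a ξ‖ = ‖a‖) : MemTraceClass (a - rankOneOp (a ξ) ξ) :=
  ⟨ha.1.sub (isCompactOperator_rankOneOp _ _),
    ((summable_nat_add_iff 1).2 ha.2).of_nonneg_of_le (fun _ => sValue_nonneg _ _)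
      (sValue_sub_rankOneOp_le hξ haξ)⟩

theorem norm_add_traceNorm_sub_rankOneOp_le [CompleteSpace H] {a : H →L[ℂ] H}
    (ha : MemTraceClass a) {ξ : H} (hξ : ‖ξ‖ = 1) (haξ : ‖a ξ‖ = ‖a‖) :
    ‖a‖ + traceNorm (a - rankOneOp (a ξ) ξ) ≤ traceNorm a := by
  rw [traceNorm, traceNorm, ha.2.tsum_eq_zero_add]
  exact add_le_add (norm_le_sValue_zero a)
    ((ha.sub_rankOneOp hξ haξ).2.tsum_le_tsum (sValue_sub_rankOneOp_le hξ haξ)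
      ((summable_nat_add_iff 1).2 ha.2))

theorem norm_le_traceNorm {a : H →L[ℂ] H} (ha : MemTraceClass a) : ‖a‖ ≤ traceNorm a :=
  (norm_le_sValue_zero a).trans (ha.2.le_tsum 0 fun n _ => sValue_nonneg a n)

/-- An element of the unit ball sending the unit vector `ξ` to the unit vector `η` is
`η ⊗ ξ`. -/
theorem eq_rankOneOp_of_apply_eq [CompleteSpace H] {x : H →L[ℂ] H} (hx : x ∈ traceBall H)
    {η ξ : H} (hη : ‖η‖ = 1) (hξ : ‖ξ‖ = 1) (h : x ξ = η) : x = rankOneOp η ξ := by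
  have h1 : ‖x‖ ≤ 1 := (norm_le_traceNorm hx.1).trans hx.2
  have h2 : ‖x‖ = 1 := by
    refine le_antisymm h1 ?_
    simpa [h, hη, hξ] using x.le_opNorm ξ
  have h3 : ‖x ξ‖ = ‖x‖ := by rw [h, hη, h2]
  have h4 := norm_add_traceNorm_sub_rankOneOp_le hx.1 hξ h3
  have h5 := norm_le_traceNorm (hx.1.sub_rankOneOp hξ h3)
  have h6 : ‖x - rankOneOp (x ξ) ξ‖ ≤ 0 := by linarith [hx.2]
  rw [norm_le_zero_iff, sub_eq_zero, h] at h6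
  exact h6

theorem rankOneOp_mem_extremePoints [CompleteSpace H] {η ξ : H} (hη : ‖η‖ = 1)
    (hξ : ‖ξ‖ = 1) : rankOneOp η ξ ∈ Set.extremePoints ℝ (traceBall H) := by
  have happ : rankOneOp η ξ ξ = η := by
    simp [rankOneOp_apply, inner_self_eq_norm_sq_to_K, hξ]
  refine mem_extremePoints_iff_left.2 ⟨⟨?_, ?_⟩, ?_⟩
  · simpa using (memTraceClass_zero (H := H)).smul_rankOneOp_add η ξ 1
  · simpa [traceNorm_zero] using
      traceNorm_smul_rankOneOp_add_le memTraceClass_zero hη hξ rfl (by simp) 1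
  · rintro x hx y hy ⟨α, β, hα, hβ, hαβ, hxy⟩
    refine eq_rankOneOp_of_apply_eq hx hη hξ ?_
    have hball : ∀ z ∈ traceBall H, ‖z ξ‖ ≤ 1 := fun z hz => by
      have h1 : ‖z‖ ≤ 1 := (norm_le_traceNorm hz.1).trans hz.2
      exact (z.le_opNorm ξ).trans (by rwa [hξ, mul_one])
    have hη' : α • x ξ + β • y ξ = η := by
      rw [← happ, ← hxy]
      rfl
    have hin : ∀ z ∈ traceBall H, RCLike.re (inner ℂ η (z ξ)) ≤ 1 := fun z hz => by
      have h2 := (RCLike.re_le_norm _).trans (norm_inner_le_norm (𝕜 := ℂ) η (z ξ))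
      rw [hη, one_mul] at h2
      exact h2.trans (hball z hz)
    have hsum : α * RCLike.re (inner ℂ η (x ξ)) + β * RCLike.re (inner ℂ η (y ξ)) = 1 := by
      have h1 : RCLike.re (inner ℂ η (α • x ξ + β • y ξ)) = 1 := by
        rw [hη', inner_self_eq_norm_sq, hη, one_pow]
      rw [inner_add_right, map_add, ← Complex.coe_smul α,
        ← Complex.coe_smul β, inner_smul_right, inner_smul_right] at h1
      simpa using h1
    have hre : 1 ≤ RCLike.re (inner ℂ η (x ξ)) := by
      have := hin y hy
      by_contra! hlt
      nlinarith [mul_lt_mul_of_pos_left hlt hα, mul_le_mul_of_nonneg_left this hβ.le]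
    have hx1 : ‖x ξ‖ ≤ 1 := hball x hx
    have hsq := norm_sub_sq (𝕜 := ℂ) η (x ξ)
    rw [hη] at hsq
    have h0 : ‖η - x ξ‖ ^ 2 = 0 :=
      le_antisymm (by nlinarith [norm_nonneg (x ξ)]) (sq_nonneg _)
    exact (sub_eq_zero.1 (norm_eq_zero.1 (sq_eq_zero_iff.1 h0))).symm

theorem le_lambdaFn {a e y : H →L[ℂ] H} {t : ℝ} (ht : t ∈ Set.Icc (0 : ℝ) 1)
    (he : e ∈ Set.extremePoints ℝ (traceBall H)) (hy : y ∈ traceBall H)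
    (h : a = t • e + (1 - t) • y) : t ≤ lambdaFn a :=
  le_csSup ⟨1, fun _ hs => hs.1.2⟩ ⟨ht, e, he, y, hy, h⟩

end TraceBall

/-- Let `H` be a complex Hilbert space. For every `a` in the closed unit ball
of `C₁(H)` one has `λ(a) ≥ (1 - ‖a‖₁ + 2‖a‖_∞) / 2`, where `‖a‖_∞` is the operator norm. -/
theorem lambdaFn_lower_bound {H : Type*} [NormedAddCommGroup H] [InnerProductSpace ℂ H]
    [CompleteSpace H] (a : H →L[ℂ] H) (ha : a ∈ traceBall H) :
    (1 - traceNorm a + 2 * ‖a‖) / 2 ≤ lambdaFn a := by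
  have hnorm := norm_le_traceNorm ha.1
  have hT := ha.2
  have hs0 := norm_nonneg a
  rcases subsingleton_or_nontrivial H with hH | hH
  · have he : a ∈ Set.extremePoints ℝ (traceBall H) :=
      mem_extremePoints_iff_left.2 ⟨ha, fun x _ _ _ _ => Subsingleton.elim x a⟩
    refine le_trans ?_ (le_lambdaFn (t := 1) (by simp) he ha (by simp))
    linarith
  obtain ⟨ξ, hξ, haξ⟩ := ha.1.1.exists_norm_apply_eq
  obtain ⟨η, hη, hηa⟩ : ∃ η : H, ‖η‖ = 1 ∧ a ξ = ‖a‖ • η := by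
    rcases eq_or_ne ‖a‖ 0 with h0 | h0
    · exact ⟨ξ, hξ, by rw [h0, zero_smul, ← norm_eq_zero, haξ, h0]⟩
    · exact ⟨‖a‖⁻¹ • a ξ, by rw [norm_smul, haξ, norm_inv, norm_norm, inv_mul_cancel₀ h0],
        by rw [smul_inv_smul₀ h0]⟩
  have hsum := norm_add_traceNorm_sub_rankOneOp_le ha.1 hξ haξ
  have hb := ha.1.sub_rankOneOp hξ haξ
  set b := a - rankOneOp (a ξ) ξ with hbdef
  have hab : a = ‖a‖ • rankOneOp η ξ + b := by
    ext u
    simp only [hbdef, hηa, rankOneOp_apply, add_apply,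
      sub_apply, smul_apply]
    rw [smul_comm]
    abel
  have hbξ : b ξ = 0 := by
    simp [hbdef, rankOneOp_apply, inner_self_eq_norm_sq_to_K, hξ]
  have hbη : ∀ u, inner ℂ η (b u) = 0 := by
    intro u
    rcases eq_or_ne a 0 with h0 | h0
    · have : b = 0 := by
        ext u
        simp [hbdef, h0, rankOneOp_apply]
      simp [this]
    · have h1 := inner_apply_sub_rankOneOp hξ haξ u
      rw [← hbdef, hηa, ← Complex.coe_smul, inner_smul_left, mul_eq_zero] at h1
      exact h1.resolve_left (by simpa using h0)
  set t := (1 - traceNorm a + 2 * ‖a‖) / 2 with ht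
  have htI : t ∈ Set.Icc (0 : ℝ) 1 := ⟨by linarith, by linarith⟩
  have he := rankOneOp_mem_extremePoints hη hξ
  set c := (‖a‖ - t) • rankOneOp η ξ + b with hc
  have hcT : MemTraceClass c := hb.smul_rankOneOp_add η ξ _
  have hcn : traceNorm c ≤ 1 - t := by
    refine (traceNorm_smul_rankOneOp_add_le hb hη hξ hbξ hbη _).trans ?_
    rw [abs_of_nonpos (by linarith)]
    linarith
  have hac : a = t • rankOneOp η ξ + c := by
    rw [hc, ← add_assoc, ← add_smul, add_sub_cancel, ← hab]
  rcases htI.2.eq_or_lt with h1 | h1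
  · refine le_lambdaFn htI he zero_mem_traceBall ?_
    have hc0 : c = 0 := norm_le_zero_iff.1 ((norm_le_traceNorm hcT).trans (by linarith))
    rw [smul_zero, ← hc0]
    exact hac
  · have hpos : 0 < 1 - t := sub_pos.2 h1
    refine le_lambdaFn htI he (y := (1 - t)⁻¹ • c) ⟨hcT.smul _, ?_⟩ ?_
    · refine (traceNorm_smul_le hcT _).trans ?_
      rw [abs_of_pos (inv_pos.2 hpos), inv_mul_le_iff₀ hpos, mul_one]
      exact hcn
    · rw [smul_inv_smul₀ hpos.ne']
      exact hac
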